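/- Duality of punctured and shortened rank metric codes: for an F_q-linear code C ⊆ F_q^{n×m}, A ∈ GL_n(F_q), and 1 ≤ s ≤ n, the trace dual of the punctured code Π(C,A,s) equals the shortened code Σ(C*, (Aᵀ)^{-1}, s), where Σ(D,B,s) consists of π_s(BY) for those Y ∈ D with the first s rows of BY zero. In particular, (AC)* = (Aᵀ)^{-1} C*. -/

import Mathlib

open Matrix

/-- Delete the first `s` rows of an `n × m` matrix (the projection `π_s`). -/
def dropRows {F : Type*} {n m s : ℕ} (h : s ≤ n) (X : Matrix (Fin n) (Fin m) F) :
    Matrix (Fin (n - s)) (Fin m) F :=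
  Matrix.of fun i j => X (Fin.cast (by omega) (Fin.natAdd s i)) j

/-- The dual code with respect to the trace bilinear form `⟨X, Y⟩ = Tr(X Yᵀ)`. -/
def dualCode {F : Type*} [Field F] {n m : ℕ} (C : Set (Matrix (Fin n) (Fin m) F)) :
    Set (Matrix (Fin n) (Fin m) F) :=
  {Y | ∀ X ∈ C, Matrix.trace (X * Yᵀ) = 0}

/-- Pad a matrix with `s` zero rows on top. -/
def padRows {F : Type*} [Zero F] {n m s : ℕ} (Z : Matrix (Fin (n - s)) (Fin m) F) :
    Matrix (Fin n) (Fin m) F :=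
  Matrix.of fun i j => if h : (i : ℕ) < s then 0 else Z ⟨i - s, by omega⟩ j

theorem padRows_apply_of_lt {F : Type*} [Zero F] {n m s : ℕ}
    (Z : Matrix (Fin (n - s)) (Fin m) F) {i : Fin n} (hi : (i : ℕ) < s) :
    padRows Z i = 0 := by
  ext j
  simp [padRows, hi]

theorem dropRows_padRows {F : Type*} [Zero F] {n m s : ℕ} (h : s ≤ n)
    (Z : Matrix (Fin (n - s)) (Fin m) F) : dropRows h (padRows Z) = Z := by
  ext i j
  simp [dropRows, padRows]

theorem trace_dropRows_mul_transpose {F : Type*} [Field F] {n m s : ℕ} (h : s ≤ n)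
    (X W : Matrix (Fin n) (Fin m) F) (hW : ∀ i : Fin n, (i : ℕ) < s → W i = 0) :
    trace (dropRows h X * (dropRows h W)ᵀ) = trace (X * Wᵀ) := by
  have hs : s + (n - s) = n := by omega
  refine Fintype.sum_of_injective (fun i : Fin (n - s) => Fin.cast hs (Fin.natAdd s i))
    (fun a b hab => by simpa [Fin.ext_iff] using hab) _ _ (fun i hi => ?_) (fun i => rfl)
  have hlt : (i : ℕ) < s := by
    by_contra hge
    exact hi ⟨⟨i - s, by omega⟩, Fin.ext (by simp; omega)⟩
  simp [mul_apply, hW i hlt]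

theorem transpose_inv_mul_transpose_mul {F : Type*} [Field F] {n m : ℕ}
    (A : GL (Fin n) F) (W : Matrix (Fin n) (Fin m) F) :
    ((A : Matrix (Fin n) (Fin n) F)ᵀ)⁻¹ * ((A : Matrix (Fin n) (Fin n) F)ᵀ * W) = W :=
  nonsing_inv_mul_cancel_left _ _
    (by simpa [det_transpose] using (isUnit_iff_isUnit_det _).1 A.isUnit)

theorem transpose_mul_transpose_inv_mul {F : Type*} [Field F] {n m : ℕ}
    (A : GL (Fin n) F) (W : Matrix (Fin n) (Fin m) F) :
    (A : Matrix (Fin n) (Fin n) F)ᵀ * (((A : Matrix (Fin n) (Fin n) F)ᵀ)⁻¹ * W) = W :=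
  mul_nonsing_inv_cancel_left _ _
    (by simpa [det_transpose] using (isUnit_iff_isUnit_det _).1 A.isUnit)

theorem trace_mul_transpose_adjoint {F : Type*} [Field F] {n m : ℕ}
    (A : Matrix (Fin n) (Fin n) F) (X W : Matrix (Fin n) (Fin m) F) :
    trace (X * (Aᵀ * W)ᵀ) = trace (A * X * Wᵀ) := by
  rw [transpose_mul, transpose_transpose, ← Matrix.mul_assoc, trace_mul_comm, Matrix.mul_assoc]

theorem trace_mul_transpose_inv_mul {F : Type*} [Field F] {n m : ℕ}
    (A : GL (Fin n) F) (X Y : Matrix (Fin n) (Fin m) F) :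
    trace ((A : Matrix (Fin n) (Fin n) F) * X *
      (((A : Matrix (Fin n) (Fin n) F)ᵀ)⁻¹ * Y)ᵀ) = trace (X * Yᵀ) := by
  rw [← trace_mul_transpose_adjoint, transpose_mul_transpose_inv_mul]

theorem stmt_5 {F : Type*} [Field F] {n m s : ℕ}
    (C : Submodule F (Matrix (Fin n) (Fin m) F))
    (A : GL (Fin n) F) (hs1 : 1 ≤ s) (hsn : s ≤ n) :
    -- the dual of the punctured code is the shortened dual code
    dualCode ((fun X => dropRows hsn ((A : Matrix (Fin n) (Fin n) F) * X)) ''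
        (C : Set (Matrix (Fin n) (Fin m) F))) =
      (fun Y => dropRows hsn (((A : Matrix (Fin n) (Fin n) F)ᵀ)⁻¹ * Y)) ''
        {Y | Y ∈ dualCode (C : Set (Matrix (Fin n) (Fin m) F)) ∧
          ∀ i : Fin n, (i : ℕ) < s → (((A : Matrix (Fin n) (Fin n) F)ᵀ)⁻¹ * Y) i = 0} ∧
    -- in particular, (A C)* = (Aᵀ)⁻¹ C*
    dualCode ((fun X => (A : Matrix (Fin n) (Fin n) F) * X) ''
        (C : Set (Matrix (Fin n) (Fin m) F))) =
      (fun Y => ((A : Matrix (Fin n) (Fin n) F)ᵀ)⁻¹ * Y) ''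
        dualCode (C : Set (Matrix (Fin n) (Fin m) F)) := by
  refine ⟨Set.Subset.antisymm ?_ ?_, Set.Subset.antisymm ?_ ?_⟩
  · intro Z hZ
    refine ⟨(A : Matrix (Fin n) (Fin n) F)ᵀ * padRows Z, ⟨fun X hX => ?_, fun i hi => ?_⟩, ?_⟩
    · rw [trace_mul_transpose_adjoint,
        ← trace_dropRows_mul_transpose hsn _ _ (fun _ => padRows_apply_of_lt Z),
        dropRows_padRows]
      exact hZ _ ⟨X, hX, rfl⟩
    · rw [transpose_inv_mul_transpose_mul]
      exact padRows_apply_of_lt Z hi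
    · simp only [transpose_inv_mul_transpose_mul, dropRows_padRows]
  · rintro _ ⟨Y, ⟨hY, hY0⟩, rfl⟩ _ ⟨X, hX, rfl⟩
    rw [trace_dropRows_mul_transpose hsn _ _ hY0, trace_mul_transpose_inv_mul]
    exact hY X hX
  · intro W hW
    refine ⟨(A : Matrix (Fin n) (Fin n) F)ᵀ * W, fun X hX => ?_,
      transpose_inv_mul_transpose_mul A W⟩
    rw [trace_mul_transpose_adjoint]
    exact hW _ ⟨X, hX, rfl⟩
  · rintro _ ⟨Y, hY, rfl⟩ _ ⟨X, hX, rfl⟩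
    rw [trace_mul_transpose_inv_mul]
    exact hY X hX
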